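/- (Negative binomial approximation via Stein's method.) Let W be a ℤ₊-valued random variable with mean λ > 0, variance v > λ, and finite third moment, admitting a Palm coupling: E[W f(W)] = ∫_Γ E[f(W + 1 + ξ_α)] λ̄(dα) for all bounded f, where λ̄(Γ) = λ and each ξ_α ≥ 0 is independent of W. Set r = λ²/(v−λ), q = λ/v. Then d_TV(W, NB(r,q)) ≤ [d_TV(W, W+1)/λ²] · { 2(v−λ)² + λ·∫_Γ E[ξ_α(ξ_α−1)] λ̄(dα) }. -/

import Mathlib

open MeasureTheory ProbabilityTheory

/-- Total variation distance between two distributions on ℤ₊. -/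
noncomputable def dTV (μ ν : Measure ℕ) : ℝ :=
  ⨆ A : Set ℕ, |(μ A).toReal - (ν A).toReal|

/-- Total variation distance between a distribution on ℤ₊ and a probability
mass function p on ℤ₊. -/
noncomputable def dTVpmf (μ : Measure ℕ) (p : ℕ → ℝ) : ℝ :=
  ⨆ A : Set ℕ, |(μ A).toReal - ∑' i : ℕ, Set.indicator A p i|

/-- The negative binomial probability mass function NB(r,q). -/
noncomputable def nbPMF (r q : ℝ) (i : ℕ) : ℝ :=
  Real.Gamma (r + i) / (Real.Gamma r * (Nat.factorial i)) * q ^ r * (1 - q) ^ i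


lemma stein_sol (a b : ℝ) (ha : 0 < a) (hb : 0 < b) (hb1 : b < 1) (p : ℕ → ℝ)
    (hp : ∀ i, 0 < p i) (hsum : HasSum p 1)
    (hdb : ∀ i : ℕ, (a + b * i) * p i = (i + 1) * p (i + 1))
    (f : ℕ → ℝ) (hf0 : ∀ i, 0 ≤ f i) (hf1 : ∀ i, f i ≤ 1) :
    ∃ g : ℕ → ℝ, (∃ C, ∀ i, |g i| ≤ C) ∧
      (∀ i : ℕ, (a + b * i) * g (i + 1) - i * g i = f i - ∑' j, p j * f j) ∧
      ∀ i, |g (i + 2) - g (i + 1)| ≤ 1 / a := by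
  have hsp : Summable p := hsum.summable
  have hspf : Summable (fun j => p j * f j) :=
    Summable.of_nonneg_of_le (fun j => mul_nonneg (hp j).le (hf0 j))
      (fun j => mul_le_of_le_one_right (hp j).le (hf1 j)) hsp
  have hci : ∀ i : ℕ, 0 < a + b * i := fun i => by positivity
  set F : ℕ → ℝ := fun i => ∑ j ∈ Finset.range i, p j with hF
  set L : ℕ → ℝ := fun i => ∑ j ∈ Finset.range i, p j * f j with hL
  set T : ℕ → ℝ := fun i => ∑' j, p (j + i) with hT
  set U : ℕ → ℝ := fun i => ∑' j, p (j + i) * f (j + i) with hU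
  set m : ℝ := ∑' j, p j * f j with hm
  have hFT : ∀ i, F i + T i = 1 := fun i => by
    rw [← hsum.tsum_eq]; exact hsp.sum_add_tsum_nat_add i
  have hLU : ∀ i, L i + U i = m := fun i => hspf.sum_add_tsum_nat_add i
  have hFs : ∀ i, F (i + 1) = F i + p i := fun i => Finset.sum_range_succ _ _
  have hLs : ∀ i, L (i + 1) = L i + p i * f i := fun i => Finset.sum_range_succ _ _
  have hF0 : ∀ i, 0 ≤ F i := fun i => Finset.sum_nonneg fun j _ => (hp j).le
  have hL0 : ∀ i, 0 ≤ L i := fun i => Finset.sum_nonneg fun j _ => mul_nonneg (hp j).le (hf0 j)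
  have hLF : ∀ i, L i ≤ F i := fun i =>
    Finset.sum_le_sum fun j _ => mul_le_of_le_one_right (hp j).le (hf1 j)
  have hsT : ∀ i, Summable (fun j => p (j + i)) := fun i => (summable_nat_add_iff i).2 hsp
  have hsU : ∀ i, Summable (fun j => p (j + i) * f (j + i)) :=
    fun i => (summable_nat_add_iff (f := fun j => p j * f j) i).2 hspf
  have hT0 : ∀ i, 0 ≤ T i := fun i => tsum_nonneg fun j => (hp _).le
  have hU0 : ∀ i, 0 ≤ U i := fun i => tsum_nonneg fun j => mul_nonneg (hp _).le (hf0 _)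
  have hUT : ∀ i, U i ≤ T i := fun i =>
    Summable.tsum_le_tsum (fun j => mul_le_of_le_one_right (hp _).le (hf1 _)) (hsU i) (hsT i)
  -- upper tail inequality
  have hup : ∀ i : ℕ, i * T (i + 1) ≤ (a + b * i) * T i := fun i => by
    simp only [hT]
    rw [← tsum_mul_left, ← tsum_mul_left]
    refine Summable.tsum_le_tsum (fun j => ?_) ((hsT _).mul_left _) ((hsT _).mul_left _)
    have h1 := hdb (j + i)
    have h2 : (0 : ℝ) < ((j + i : ℕ) : ℝ) + 1 := by positivity
    rw [← add_assoc]
    refine le_of_mul_le_mul_left ?_ h2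
    have h3 : (((j + i : ℕ) : ℝ) + 1) * (i * p (j + i + 1))
      = (i * (a + b * ((j + i : ℕ) : ℝ))) * p (j + i) := by
      linear_combination (-(i : ℝ)) * h1
    rw [h3, ← mul_assoc]
    refine mul_le_mul_of_nonneg_right ?_ (hp _).le
    push_cast
    have : (0 : ℝ) ≤ a * j + a + b * i := by positivity
    nlinarith
  -- lower tail inequality
  have hlow' : ∀ i : ℕ, i * F (i + 1) - (a + b * i) * F i
      = (1 - b) * ∑ j ∈ Finset.range i, F (j + 1) := by
    intro i
    induction i with
    | zero => simp [hF]
    | succ i ih =>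
      rw [Finset.sum_range_succ, mul_add, ← ih, hFs (i + 1), hFs i]
      push_cast
      linear_combination (-1 : ℝ) * hdb i
  have hlow : ∀ i : ℕ, (a + b * i) * F i ≤ i * F (i + 1) := fun i => by
    have : 0 ≤ (1 - b) * ∑ j ∈ Finset.range i, F (j + 1) :=
      mul_nonneg (by linarith) (Finset.sum_nonneg fun j _ => hF0 _)
    linarith [hlow' i]
  -- factor bound
  have hfac : ∀ i : ℕ, a * F i ≤ i * F (i + 1) := fun i => by
    have : 0 ≤ b * i * F i := by have := hF0 i; positivity
    linarith [hlow i]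
  set h : ℕ → ℝ := fun i => (L (i + 1) - m * F (i + 1)) / ((a + b * i) * p i) with hh
  have hc : ∀ i : ℕ, 0 < (a + b * i) * p i := fun i => mul_pos (hci i) (hp i)
  have hbd : ∀ i, T (i + 1) / ((a + b * i) * p i) ≤ T 1 / (a * p 0) := by
    intro i
    induction i with
    | zero => simp
    | succ i ih =>
      refine le_trans ?_ ih
      rw [div_le_div_iff₀ (hc _) (hc _), hdb i]
      have h1 := mul_le_mul_of_nonneg_right (hup (i + 1)) (hp (i + 1)).le
      push_cast at h1 ⊢
      linarith
  have hhb : ∀ i, |h i| ≤ T 1 / (a * p 0) := fun i => by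
    refine le_trans ?_ (hbd i)
    rw [hh]
    simp only
    rw [abs_div, abs_of_pos (hc i)]
    refine div_le_div_of_nonneg_right ?_ (hc i).le
    have e : L (i + 1) - m * F (i + 1) = L (i + 1) * T (i + 1) - U (i + 1) * F (i + 1) := by
      linear_combination F (i+1) * hLU (i + 1) - L (i + 1) * hFT (i + 1)
    have k1 := hFT (i + 1)
    have k2 := mul_le_mul_of_nonneg_right (hLF (i + 1)) (hT0 (i + 1))
    have k3 := mul_le_mul_of_nonneg_right (hUT (i + 1)) (hF0 (i + 1))
    have k4 := mul_nonneg (hL0 (i + 1)) (hT0 (i + 1))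
    have k5 := mul_nonneg (hU0 (i + 1)) (hF0 (i + 1))
    have k6 := mul_nonneg (hT0 (i + 1)) (hT0 (i + 1))
    have k7 : T (i + 1) = F (i + 1) * T (i + 1) + T (i + 1) * T (i + 1) := by
      linear_combination (-T (i + 1)) * k1
    rw [e, abs_le]
    constructor <;> nlinarith
  refine ⟨fun i => h (i - 1), ⟨_, fun i => hhb _⟩, ?_, ?_⟩
  · intro i
    rcases i with _ | i
    · simp [hh, hL, hF]
      have := (hp 0).ne'
      field_simp
    · simp only [Nat.add_sub_cancel]
      have e1 : (a + b * ((i + 1 : ℕ) : ℝ)) * h (i + 1)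
          = (L (i + 2) - m * F (i + 2)) / p (i + 1) := by
        have := (hci (i + 1)).ne'
        have := (hp (i + 1)).ne'
        simp only [hh]
        field_simp
      have e2 : ((i + 1 : ℕ) : ℝ) * h i = (L (i + 1) - m * F (i + 1)) / p (i + 1) := by
        simp only [hh]
        rw [hdb i]
        have := (hp (i + 1)).ne'
        push_cast
        field_simp
      rw [e1, e2, hLs (i + 1), hFs (i + 1)]
      have := (hp (i + 1)).ne'
      field_simp
      ring
  · intro i
    change |h (i + 1) - h i| ≤ 1 / a
    obtain ⟨n, hn⟩ : ∃ n : ℕ, n = i + 1 := ⟨_, rfl⟩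
    have hn0 : (0 : ℝ) < n := by rw [hn]; positivity
    have e2 : h i = (L n - m * F n) / (n * p n) := by
      simp only [hh]; rw [hdb i, hn]; push_cast; rfl
    rw [e2, ← hn]
    simp only [hh]
    have hcn := hci n
    have hpn := hp n
    have l1 := hup n
    have l2 := hlow n
    have l3 := hfac n
    have r1 := hFT (n + 1)
    have r2 := hLU (n + 1)
    rw [hLs] at r2 ⊢
    rw [hFs] at l2 l3 r1 ⊢
    have r0 := hFT n
    have hl0 := hL0 n
    have hlf := hLF n
    have hu0 := hU0 (n + 1)
    have hut := hUT (n + 1)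
    have ht0 := hT0 (n + 1)
    have hF0n := hF0 n
    have hTn : T n = p n + T (n + 1) := by linarith
    rw [hTn] at l1
    have hbn : a ≤ a + b * n := by have : 0 ≤ b * (n : ℝ) := by positivity
                                   linarith
    have f0 := hf0 n
    have f1 := hf1 n
    generalize a + b * (n : ℝ) = c at *
    generalize T (n + 1) = t at *
    generalize U (n + 1) = u at *
    generalize L n = l at *
    generalize F n = s at *
    generalize p n = w at *
    generalize f n = x at *
    generalize (n : ℝ) = y at *
    have key : (l + w * x - m * (s + w)) / (c * w) - (l - m * s) / (y * w)
       = x * (t / c + s / y) - (l * (c * (w + t) - y * t) + u * (y * (s + w) - c * s)) / (c * y * w) := by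
      rw [← r2]
      have ht : t = 1 - s - w := by linarith
      rw [ht]
      field_simp
      ring
    have key2 : (s * (c * (w + t) - y * t) + t * (y * (s + w) - c * s)) / (c * y * w) = t / c + s / y := by
      field_simp
      ring
    have b1 : t / c + s / y ≤ 1 / a := by
      have q1 : t / c ≤ t / a := div_le_div_of_nonneg_left ht0 ha hbn
      have q2 : s / y ≤ (s + w) / a := by rw [div_le_div_iff₀ hn0 ha]; linarith
      have q3 : t / a + (s + w) / a = 1 / a := by rw [← add_div]; congr 1; linarith
      linarith
    have b0 : 0 ≤ t / c + s / y := by positivity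
    have c1 : 0 ≤ c * (w + t) - y * t := by linarith
    have c2 : 0 ≤ y * (s + w) - c * s := by linarith
    have b2 : 0 ≤ (l * (c * (w + t) - y * t) + u * (y * (s + w) - c * s)) / (c * y * w) := by
      positivity
    have b3 : (l * (c * (w + t) - y * t) + u * (y * (s + w) - c * s)) / (c * y * w)
        ≤ t / c + s / y := by
      rw [← key2]
      gcongr
    have b4 : 0 ≤ x * (t / c + s / y) := by positivity
    have b5 : x * (t / c + s / y) ≤ t / c + s / y := mul_le_of_le_one_left b0 f1
    rw [key, abs_le]
    constructor <;> linarith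

lemma nb_pos {r q : ℝ} (hr : 0 < r) (hq : 0 < q) (hq1 : q < 1) (i : ℕ) : 0 < nbPMF r q i := by
  unfold nbPMF
  have h1 : 0 < Real.Gamma (r + i) := Real.Gamma_pos_of_pos (by positivity)
  have h2 : 0 < Real.Gamma r := Real.Gamma_pos_of_pos hr
  have h3 : 0 < 1 - q := by linarith
  have h4 : 0 < q ^ r := Real.rpow_pos_of_pos hq r
  positivity

lemma nb_db {r q : ℝ} (hr : 0 < r) (i : ℕ) :
    (r * (1 - q) + (1 - q) * i) * nbPMF r q i = (i + 1) * nbPMF r q (i + 1) := by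
  unfold nbPMF
  have h2 : 0 < Real.Gamma r := Real.Gamma_pos_of_pos hr
  have h3 : Real.Gamma (r + (i + 1 : ℕ)) = (r + i) * Real.Gamma (r + i) := by
    rw [← Real.Gamma_add_one (by positivity)]
    push_cast; ring_nf
  rw [h3, Nat.factorial_succ, pow_succ]
  push_cast
  field_simp

lemma nb_coeff {r : ℝ} (hr : 0 < r) (n : ℕ) :
    Ring.choose (r + n - 1) n = Real.Gamma (r + n) / (Real.Gamma r * (Nat.factorial n)) := by
  have h2 : 0 < Real.Gamma r := Real.Gamma_pos_of_pos hr
  have h1 : (ascPochhammer ℝ n).eval r = Real.Gamma (r + n) / Real.Gamma r := by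
    induction n with
    | zero => simp [h2.ne']
    | succ n ih =>
      rw [ascPochhammer_succ_eval, ih]
      have h3 : Real.Gamma (r + (n + 1 : ℕ)) = (r + n) * Real.Gamma (r + n) := by
        rw [← Real.Gamma_add_one (by positivity)]
        push_cast; ring_nf
      rw [h3]; ring
  rw [← Ring.multichoose_eq]
  have h4 := Ring.factorial_nsmul_multichoose_eq_ascPochhammer r n
  rw [Polynomial.ascPochhammer_smeval_eq_eval, h1, nsmul_eq_mul] at h4
  have : (0 : ℝ) < (Nat.factorial n : ℝ) := by positivity
  field_simp at h4 ⊢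
  linarith

lemma nb_hasSum {r q : ℝ} (hr : 0 < r) (hq : 0 < q) (hq1 : q < 1) : HasSum (nbPMF r q) 1 := by
  have h := (Real.one_div_one_sub_rpow_hasFPowerSeriesOnBall_zero r).hasSum (y := 1 - q) (by
    simp only [Metric.mem_eball, edist_zero_right]
    rw [← ofReal_norm, Real.norm_eq_abs, abs_of_pos (by linarith)]
    rw [ENNReal.ofReal_lt_one]; linarith)
  have h4 : 0 < q ^ r := Real.rpow_pos_of_pos hq r
  have h' := h.mul_left (q ^ r)
  simp only [zero_add, sub_sub_cancel] at h'
  rw [mul_one_div_cancel h4.ne'] at h'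
  have e : ∀ n, nbPMF r q n = q ^ r * (FormalMultilinearSeries.ofScalars ℝ
      (fun n : ℕ => Ring.choose (r + ↑n - 1) n) n) fun _ => 1 - q := by
    intro n
    rw [FormalMultilinearSeries.ofScalars_apply_eq, smul_eq_mul, nb_coeff hr]
    unfold nbPMF
    ring
  exact (funext e : nbPMF r q = _) ▸ h'

lemma dTV_bdd (μ ν : Measure ℕ) [IsProbabilityMeasure μ] [IsProbabilityMeasure ν] :
    BddAbove (Set.range fun A : Set ℕ => |(μ A).toReal - (ν A).toReal|) := by
  refine ⟨1, ?_⟩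
  rintro _ ⟨A, rfl⟩
  have h1 : μ.real A ≤ 1 := measureReal_le_one
  have h2 : ν.real A ≤ 1 := measureReal_le_one
  have h3 : 0 ≤ μ.real A := measureReal_nonneg
  have h4 : 0 ≤ ν.real A := measureReal_nonneg
  change |μ.real A - ν.real A| ≤ 1
  rw [abs_le]; constructor <;> linarith

lemma le_dTV (μ ν : Measure ℕ) [IsProbabilityMeasure μ] [IsProbabilityMeasure ν] (A : Set ℕ) :
    |μ.real A - ν.real A| ≤ dTV μ ν := le_ciSup (dTV_bdd μ ν) A

lemma dTV_nonneg' (μ ν : Measure ℕ) [IsProbabilityMeasure μ] [IsProbabilityMeasure ν] :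
    0 ≤ dTV μ ν := (abs_nonneg _).trans (le_dTV μ ν ∅)

lemma bdd_integrable {Ω : Type*} [MeasurableSpace Ω] {P : Measure Ω} [IsFiniteMeasure P]
    {h : ℕ → ℝ} {C : ℝ} (hh : ∀ i, |h i| ≤ C) {X : Ω → ℕ} (hX : Measurable X) :
    Integrable (fun ω => h (X ω)) P :=
  Integrable.of_bound ((measurable_of_countable h).comp hX).aestronglyMeasurable C
    (Filter.Eventually.of_forall fun _ => hh _)

lemma tv_bound (μ ν : Measure ℕ) [IsProbabilityMeasure μ] [IsProbabilityMeasure ν]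
    (h : ℕ → ℝ) (M : ℝ) (hM : 0 ≤ M) (hh : ∀ i, |h i| ≤ M) :
    |∫ i, h i ∂μ - ∫ i, h i ∂ν| ≤ 2 * M * dTV μ ν := by
  have key : ∀ (ρ : Measure ℕ) [IsProbabilityMeasure ρ] (k : ℕ → ℝ) (C : ℝ), (∀ i, |k i| ≤ C) →
      HasSum (fun i => ρ.real {i} * k i) (∫ i, k i ∂ρ) := by
    intro ρ _ k C hk
    have hi : Integrable k ρ := bdd_integrable hk measurable_id
    have := hasSum_integral_measure (μ := fun i => ρ {i} • Measure.dirac i) (f := k)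
      (by rwa [Measure.sum_smul_dirac])
    rw [Measure.sum_smul_dirac] at this
    simpa [integral_smul_measure, measureReal_def] using this
  set A : Set ℕ := {i | ν.real {i} ≤ μ.real {i}} with hA
  have hind : ∀ (B : Set ℕ) (i : ℕ), |B.indicator (fun _ => (1:ℝ)) i| ≤ 1 := by
    intro B i; by_cases hi : i ∈ B <;> simp [hi]
  have hμ := key μ h M hh
  have hν := key ν h M hh
  have i1 := key μ _ 1 (hind A)
  have i2 := key ν _ 1 (hind A)
  have i3 := key μ _ 1 (hind Aᶜ)
  have i4 := key ν _ 1 (hind Aᶜ)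
  rw [integral_indicator_const _ (MeasurableSet.of_discrete)] at i1 i2 i3 i4
  simp only [smul_eq_mul, mul_one] at i1 i2 i3 i4
  have hs := hμ.sub hν
  have hb := ((i1.sub i2).sub (i3.sub i4)).mul_left M
  have hle : ∀ i, |μ.real {i} * h i - ν.real {i} * h i| ≤
      M * (μ.real {i} * A.indicator (fun _ => (1:ℝ)) i - ν.real {i} * A.indicator (fun _ => (1:ℝ)) i
        - (μ.real {i} * Aᶜ.indicator (fun _ => (1:ℝ)) i
          - ν.real {i} * Aᶜ.indicator (fun _ => (1:ℝ)) i)) := by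
    intro i
    rw [← sub_mul, abs_mul, mul_comm]
    by_cases hi : i ∈ A
    · have : ν.real {i} ≤ μ.real {i} := hi
      simp only [hi, Set.indicator_of_mem, Set.mem_compl_iff, not_true_eq_false, not_false_eq_true,
        Set.indicator_of_notMem, mul_one, mul_zero, sub_zero]
      rw [abs_of_nonneg (sub_nonneg.2 this)]
      exact mul_le_mul_of_nonneg_right (hh i) (sub_nonneg.2 this)
    · have : μ.real {i} < ν.real {i} := not_le.1 hi
      have h' : i ∈ Aᶜ := hi
      simp only [hi, h', Set.indicator_of_mem, not_false_eq_true,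
        Set.indicator_of_notMem, mul_one, mul_zero, sub_zero, zero_sub, neg_sub]
      rw [abs_of_neg (sub_neg.2 this), neg_sub]
      exact mul_le_mul_of_nonneg_right (hh i) (sub_nonneg.2 this.le)
  have h1 : ∫ i, h i ∂μ - ∫ i, h i ∂ν ≤ _ := hasSum_le (fun i => (le_abs_self _).trans (hle i)) hs hb
  have h2 := hasSum_le (fun i => (neg_le_abs _).trans (hle i)) hs.neg hb
  have j1 := (abs_le.1 (le_dTV μ ν A)).2
  have j2 := (abs_le.1 (le_dTV μ ν Aᶜ)).1
  have j3 : M * (μ.real A - ν.real A - (μ.real Aᶜ - ν.real Aᶜ)) ≤ M * (2 * dTV μ ν) :=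
    mul_le_mul_of_nonneg_left (by linarith) hM
  rw [abs_le]; constructor <;> linarith

section
variable {Ω : Type*} [MeasurableSpace Ω] (P : Measure Ω) [IsProbabilityMeasure P]

lemma shift_bound (W : Ω → ℕ) (hW : Measurable W)
    (h : ℕ → ℝ) (M : ℝ) (hM : 0 ≤ M) (hh : ∀ i, |h i| ≤ M) (k : ℕ) :
    |∫ ω, h (W ω + k) ∂P - ∫ ω, h (W ω) ∂P| ≤
      2 * M * dTV (P.map W) (P.map (fun ω => W ω + 1)) * k := by
  have hW1 : Measurable (fun ω => W ω + 1) := by fun_prop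
  have : IsProbabilityMeasure (P.map W) := Measure.isProbabilityMeasure_map hW.aemeasurable
  have : IsProbabilityMeasure (P.map (fun ω => W ω + 1)) :=
    Measure.isProbabilityMeasure_map hW1.aemeasurable
  induction k with
  | zero => simp
  | succ k ih =>
    have h1 := tv_bound (P.map W) (P.map (fun ω => W ω + 1)) (fun i => h (i + k)) M hM
      (fun i => hh _)
    rw [integral_map hW.aemeasurable (measurable_of_countable _).aestronglyMeasurable,
      integral_map hW1.aemeasurable (measurable_of_countable _).aestronglyMeasurable] at h1
    have e : ∀ ω, W ω + 1 + k = W ω + (k + 1) := fun ω => by ring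
    simp only [e] at h1
    rw [abs_le] at *
    push_cast
    constructor <;> linarith [h1.1, h1.2, ih.1, ih.2]

lemma indep_integral (W X : Ω → ℕ) (hW : Measurable W) (hX : Measurable X) (hind : IndepFun X W P)
    (f : ℕ → ℝ) (C : ℝ) (hf : ∀ i, |f i| ≤ C) :
    ∫ ω, f (W ω + 1 + X ω) ∂P = ∫ ω, (fun k => ∫ ω', f (W ω' + 1 + k) ∂P) (X ω) ∂P := by
  have hm := hind.map_prod_eq_prod_map_map hX.aemeasurable hW.aemeasurable
  have : IsProbabilityMeasure (P.map W) := Measure.isProbabilityMeasure_map hW.aemeasurable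
  have : IsProbabilityMeasure (P.map X) := Measure.isProbabilityMeasure_map hX.aemeasurable
  have h1 : ∫ ω, f (W ω + 1 + X ω) ∂P
      = ∫ z : ℕ × ℕ, f (z.2 + 1 + z.1) ∂(P.map (fun ω => (X ω, W ω))) := by
    rw [integral_map (hX.prodMk hW).aemeasurable (measurable_of_countable _).aestronglyMeasurable]
  rw [h1, hm, integral_prod]
  · rw [integral_map hX.aemeasurable (measurable_of_countable _).aestronglyMeasurable]
    congr 1; ext ω
    rw [integral_map hW.aemeasurable (measurable_of_countable _).aestronglyMeasurable]
  · exact Integrable.of_bound (measurable_of_countable _).aestronglyMeasurable C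
      (Filter.Eventually.of_forall fun ω => hf _)

/-- purely real estimate -/
lemma seq_est (u : ℕ → ℝ) (b K : ℝ) (hb : 0 ≤ b) (hb1 : b ≤ 1)
    (hu : ∀ k : ℕ, |(u (k + 1) - u k) - (u 1 - u 0)| ≤ 2 * K * k) (k : ℕ) :
    |(1 - b) * u 0 + b * u (k + 1) - u k - b * (u 1 - u 0) + (1 - b) * (u 1 - u 0) * k| ≤
      b * 2 * K * k + (1 - b) * K * (k * (k - 1)) := by
  have h1 : ∀ k : ℕ, |u k - u 0 - k * (u 1 - u 0)| ≤ K * (k * (k - 1)) := by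
    intro k
    induction k with
    | zero => simp
    | succ k ih =>
      have := hu k
      rw [abs_le] at *
      push_cast
      constructor <;> linarith [this.1, this.2, ih.1, ih.2]
  have e : (1 - b) * u 0 + b * u (k + 1) - u k - b * (u 1 - u 0) + (1 - b) * (u 1 - u 0) * k
      = b * ((u (k + 1) - u k) - (u 1 - u 0)) - (1 - b) * (u k - u 0 - k * (u 1 - u 0)) := by ring
  rw [e]
  refine (abs_sub _ _).trans ?_
  rw [abs_mul, abs_mul, abs_of_nonneg hb, abs_of_nonneg (by linarith : 0 ≤ 1 - b)]
  have := mul_le_mul_of_nonneg_left (hu k) hb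
  have := mul_le_mul_of_nonneg_left (h1 k) (by linarith : 0 ≤ 1 - b)
  linarith

variable {Γ : Type*} [MeasurableSpace Γ] (lamBar : Measure Γ) [IsFiniteMeasure lamBar]

lemma coupling_integrable (W : Ω → ℕ) (hWmeas : Measurable W)
    (hW1 : Integrable (fun ω => (W ω : ℝ)) P) (hpos : 0 < ∫ ω, (W ω : ℝ) ∂P)
    (ξ : Γ → Ω → ℕ) (hξmeas : ∀ α, Measurable (ξ α))
    (hcoupling : ∀ f : ℕ → ℝ, (∃ C : ℝ, ∀ i, |f i| ≤ C) →
      ∫ ω, (W ω : ℝ) * f (W ω) ∂P = ∫ α, (∫ ω, f (W ω + 1 + ξ α ω) ∂P) ∂lamBar)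
    (f : ℕ → ℝ) (C : ℝ) (hf : ∀ i, |f i| ≤ C) :
    Integrable (fun α => ∫ ω, f (W ω + 1 + ξ α ω) ∂P) lamBar := by
  have hm : ∀ α, Measurable (fun ω => W ω + 1 + ξ α ω) := fun α =>
    (hWmeas.add_const 1).add (hξmeas α)
  have h1 := hcoupling (fun i => f i + (C + 1)) ⟨C + |C + 1|, fun i =>
    (abs_add_le _ _).trans (by linarith [hf i])⟩
  have h2 : 0 < ∫ ω, (W ω : ℝ) * (f (W ω) + (C + 1)) ∂P := by
    refine lt_of_lt_of_le hpos (integral_mono hW1 ?_ ?_)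
    · refine hW1.mul_bdd (c := C + |C + 1|) ?_ ?_
      · exact (measurable_of_countable (fun i : ℕ => f i + (C + 1))).comp hWmeas |>.aestronglyMeasurable
      · exact Filter.Eventually.of_forall fun ω =>
          (abs_add_le _ _).trans (by linarith [hf (W ω)])
    · intro ω
      have := (abs_le.1 (hf (W ω))).1
      exact le_mul_of_one_le_right (by positivity) (by linarith)
  have h3 : Integrable (fun α => ∫ ω, (f (W ω + 1 + ξ α ω) + (C + 1)) ∂P) lamBar := by
    by_contra hc
    rw [integral_undef hc] at h1
    linarith
  have h4 := h3.sub (integrable_const (C + 1))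
  refine h4.congr (Filter.Eventually.of_forall fun α => ?_)
  simp only [Pi.sub_apply]
  rw [integral_add (bdd_integrable hf (hm α)) (integrable_const _)]
  simp

lemma coupling_nonneg (W : Ω → ℕ) (hWmeas : Measurable W)
    (hW1 : Integrable (fun ω => (W ω : ℝ)) P) (hpos : 0 < ∫ ω, (W ω : ℝ) ∂P)
    (ξ : Γ → Ω → ℕ) (hξmeas : ∀ α, Measurable (ξ α))
    (hcoupling : ∀ f : ℕ → ℝ, (∃ C : ℝ, ∀ i, |f i| ≤ C) →
      ∫ ω, (W ω : ℝ) * f (W ω) ∂P = ∫ α, (∫ ω, f (W ω + 1 + ξ α ω) ∂P) ∂lamBar)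
    (f : ℕ → ℝ) (hf : ∀ i, 0 ≤ f i) (hWf : Integrable (fun ω => (W ω : ℝ) * f (W ω)) P) :
    (∀ᵐ α ∂lamBar, Integrable (fun ω => f (W ω + 1 + ξ α ω)) P) ∧
    Integrable (fun α => ∫ ω, f (W ω + 1 + ξ α ω) ∂P) lamBar ∧
    ∫ α, (∫ ω, f (W ω + 1 + ξ α ω) ∂P) ∂lamBar = ∫ ω, (W ω : ℝ) * f (W ω) ∂P := by
  have hm : ∀ α, Measurable (fun ω => W ω + 1 + ξ α ω) := fun α =>
    (hWmeas.add_const 1).add (hξmeas α)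
  have hfb : ∀ n : ℕ, ∀ i, |min (f i) n| ≤ n := fun n i => by
    rw [abs_of_nonneg (le_min (hf i) (by positivity))]; exact min_le_right _ _
  have hf0 : ∀ n : ℕ, ∀ i, 0 ≤ min (f i) n := fun n i => le_min (hf i) (by positivity)
  have hsup : ∀ i, ⨆ n : ℕ, ENNReal.ofReal (min (f i) n) = ENNReal.ofReal (f i) := fun i => by
    refine le_antisymm (iSup_le fun n => ENNReal.ofReal_le_ofReal (min_le_left _ _)) ?_
    obtain ⟨n, hn⟩ := exists_nat_ge (f i)
    exact le_iSup_of_le n (by rw [min_eq_left hn])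
  have hmon : ∀ i, Monotone fun n : ℕ => ENNReal.ofReal (min (f i) n) := fun i n m hnm =>
    ENNReal.ofReal_le_ofReal (min_le_min_left _ (by exact_mod_cast hnm))
  -- inner
  have hin : ∀ α, ∫⁻ ω, ENNReal.ofReal (f (W ω + 1 + ξ α ω)) ∂P
      = ⨆ n : ℕ, ENNReal.ofReal (∫ ω, min (f (W ω + 1 + ξ α ω)) n ∂P) := fun α => by
    simp_rw [← hsup]
    rw [lintegral_iSup]
    · congr 1; ext n
      rw [ofReal_integral_eq_lintegral_ofReal
        (bdd_integrable (h := fun i => min (f i) n) (hfb n) (hm α))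
        (Filter.Eventually.of_forall fun ω => hf0 n _)]
    · intro n
      exact (measurable_of_countable (fun i : ℕ => ENNReal.ofReal (min (f i) n))).comp (hm α)
    · intro n m hnm ω
      exact hmon _ hnm
  have hI : ∀ n : ℕ, Integrable (fun α => ∫ ω, min (f (W ω + 1 + ξ α ω)) n ∂P) lamBar := fun n =>
    coupling_integrable P lamBar W hWmeas hW1 hpos ξ hξmeas hcoupling (fun i => min (f i) n) n (hfb n)
  have hae : AEMeasurable (fun α => ∫⁻ ω, ENNReal.ofReal (f (W ω + 1 + ξ α ω)) ∂P) lamBar := by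
    simp_rw [hin]
    exact AEMeasurable.iSup fun n => (hI n).1.aemeasurable.ennreal_ofReal
  have hWn : ∀ n : ℕ, Integrable (fun ω => (W ω : ℝ) * min (f (W ω)) n) P := fun n => by
    refine hW1.mul_bdd (c := n) ?_ ?_
    · exact (measurable_of_countable (fun i : ℕ => min (f i) n)).comp hWmeas |>.aestronglyMeasurable
    · exact Filter.Eventually.of_forall fun ω => hfb n _
  have htot : ∫⁻ α, ∫⁻ ω, ENNReal.ofReal (f (W ω + 1 + ξ α ω)) ∂P ∂lamBar
      = ENNReal.ofReal (∫ ω, (W ω : ℝ) * f (W ω) ∂P) := by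
    simp_rw [hin]
    rw [lintegral_iSup']
    · rw [ofReal_integral_eq_lintegral_ofReal hWf
        (Filter.Eventually.of_forall fun ω => mul_nonneg (by positivity) (hf _))]
      have : ∀ ω, ENNReal.ofReal ((W ω : ℝ) * f (W ω))
          = ⨆ n : ℕ, ENNReal.ofReal ((W ω : ℝ) * min (f (W ω)) n) := fun ω => by
        simp_rw [ENNReal.ofReal_mul (Nat.cast_nonneg (W ω))]
        rw [← ENNReal.mul_iSup, hsup]
      simp_rw [this]
      rw [lintegral_iSup]
      · congr 1; ext n
        rw [← ofReal_integral_eq_lintegral_ofReal (hI n)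
          (Filter.Eventually.of_forall fun α => integral_nonneg fun ω => hf0 n _),
          ← ofReal_integral_eq_lintegral_ofReal (hWn n)
          (Filter.Eventually.of_forall fun α => mul_nonneg (by positivity) (hf0 n _)),
          hcoupling (fun i => min (f i) n) ⟨n, hfb n⟩]
      · intro n
        exact (measurable_of_countable (fun i : ℕ => ENNReal.ofReal (i * min (f i) n))).comp hWmeas
      · intro n m hnm ω
        exact ENNReal.ofReal_le_ofReal (mul_le_mul_of_nonneg_left
          (min_le_min_left _ (by exact_mod_cast hnm)) (by positivity))
    · exact fun n => (hI n).1.aemeasurable.ennreal_ofReal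
    · refine Filter.Eventually.of_forall fun α n m hnm => ENNReal.ofReal_le_ofReal ?_
      refine integral_mono (bdd_integrable (h := fun i => min (f i) n) (hfb n) (hm α))
        (bdd_integrable (h := fun i => min (f i) m) (hfb m) (hm α)) fun ω =>
          min_le_min_left _ (Nat.cast_le.2 hnm)
  have hne : ∫⁻ α, ∫⁻ ω, ENNReal.ofReal (f (W ω + 1 + ξ α ω)) ∂P ∂lamBar ≠ ⊤ := by
    rw [htot]; exact ENNReal.ofReal_ne_top
  have hms : ∀ α, AEStronglyMeasurable (fun ω => f (W ω + 1 + ξ α ω)) P := fun α =>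
    ((measurable_of_countable f).comp (hm α)).aestronglyMeasurable
  have heq : (fun α => ∫ ω, f (W ω + 1 + ξ α ω) ∂P) =
      fun α => (∫⁻ ω, ENNReal.ofReal (f (W ω + 1 + ξ α ω)) ∂P).toReal := by
    ext α
    rw [integral_eq_lintegral_of_nonneg_ae (Filter.Eventually.of_forall fun ω => hf _) (hms α)]
  have hlt := ae_lt_top' hae hne
  refine ⟨?_, ?_, ?_⟩
  · filter_upwards [hlt] with α hα
    exact (lintegral_ofReal_ne_top_iff_integrable (hms α)
      (Filter.Eventually.of_forall fun ω => hf _)).1 hα.ne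
  · rw [heq]; exact integrable_toReal_of_lintegral_ne_top hae hne
  · rw [heq, integral_toReal hae hlt, htot, ENNReal.toReal_ofReal]
    exact integral_nonneg fun ω => mul_nonneg (by positivity) (hf _)
end

lemma lin3 {X : Type*} [MeasurableSpace X] {μ : Measure X} {x y z : X → ℝ}
    (hx : Integrable x μ) (hy : Integrable y μ) (hz : Integrable z μ) (c1 c2 : ℝ) :
    ∫ t, (c1 * x t + c2 * y t - z t) ∂μ
      = c1 * ∫ t, x t ∂μ + c2 * ∫ t, y t ∂μ - ∫ t, z t ∂μ := by
  have h1 : Integrable (fun t => c1 * x t) μ := hx.const_mul _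
  have h2 : Integrable (fun t => c2 * y t) μ := hy.const_mul _
  have h3 : Integrable (fun t => c1 * x t + c2 * y t) μ := h1.add h2
  rw [integral_sub h3 hz, integral_add h1 h2, integral_const_mul, integral_const_mul]

lemma lin5 {X : Type*} [MeasurableSpace X] {μ : Measure X} [IsFiniteMeasure μ] {x y z : X → ℝ}
    (hx : Integrable x μ) (hy : Integrable y μ) (hz : Integrable z μ) (c0 c1 c2 c3 : ℝ) :
    ∫ t, (c0 + c1 * x t - y t - c2 + c3 * z t) ∂μ
      = c0 * μ.real Set.univ + c1 * ∫ t, x t ∂μ - ∫ t, y t ∂μ - c2 * μ.real Set.univ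
        + c3 * ∫ t, z t ∂μ := by
  have h0 : Integrable (fun t => c0 + c1 * x t) μ := (integrable_const _).add (hx.const_mul _)
  have h1 : Integrable (fun t => c0 + c1 * x t - y t) μ := h0.sub hy
  have h2 : Integrable (fun t => c0 + c1 * x t - y t - c2) μ := h1.sub (integrable_const _)
  rw [integral_add h2 (hz.const_mul _), integral_sub h1 (integrable_const _), integral_sub h0 hy,
    integral_add (integrable_const _) (hx.const_mul _), integral_const_mul, integral_const_mul,
    integral_const, integral_const, smul_eq_mul, smul_eq_mul]
  ring

/-- Negative binomial approximation via Stein's method: under the Palm coupling,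
with r = λ²/(v−λ) and q = λ/v,
d_TV(W, NB(r,q)) ≤ [d_TV(W,W+1)/λ²]·{2(v−λ)² + λ∫_Γ E[ξ_α(ξ_α−1)] λ̄(dα)}. -/
theorem negBinomial_stein_approximation
    {Ω : Type*} [MeasurableSpace Ω] (P : Measure Ω) [IsProbabilityMeasure P]
    {Γ : Type*} [MeasurableSpace Γ] (lamBar : Measure Γ) [IsFiniteMeasure lamBar]
    (W : Ω → ℕ) (hWmeas : Measurable W)
    (lam v : ℝ) (hlam : lam = ∫ ω, (W ω : ℝ) ∂P) (hlampos : 0 < lam)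
    (hv : v = variance (fun ω => (W ω : ℝ)) P) (hvlam : lam < v)
    (hW3 : Integrable (fun ω => (W ω : ℝ) ^ 3) P)
    (hmass : (lamBar Set.univ).toReal = lam)
    (ξ : Γ → Ω → ℕ) (hξmeas : ∀ α, Measurable (ξ α))
    (hξindep : ∀ α, IndepFun (ξ α) W P)
    (hξint : Integrable (fun α => ∫ ω, (ξ α ω : ℝ) * ((ξ α ω : ℝ) - 1) ∂P) lamBar)
    (hcoupling : ∀ f : ℕ → ℝ, (∃ C : ℝ, ∀ i, |f i| ≤ C) →
      ∫ ω, (W ω : ℝ) * f (W ω) ∂P = ∫ α, (∫ ω, f (W ω + 1 + ξ α ω) ∂P) ∂lamBar)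
    (r q : ℝ) (hr : r = lam ^ 2 / (v - lam)) (hq : q = lam / v) :
    dTVpmf (P.map W) (nbPMF r q) ≤
      (dTV (P.map W) (P.map (fun ω => W ω + 1)) / lam ^ 2) *
        (2 * (v - lam) ^ 2 +
          lam * ∫ α, (∫ ω, (ξ α ω : ℝ) * ((ξ α ω : ℝ) - 1) ∂P) ∂lamBar) := by
  have hvpos : 0 < v := hlampos.trans hvlam
  have hcube : ∀ n : ℕ, (n : ℝ) ≤ (n : ℝ) ^ 3 ∧ (n : ℝ) ^ 2 ≤ (n : ℝ) ^ 3 := fun n => by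
    constructor
    · exact_mod_cast Nat.le_self_pow (by norm_num) n
    · rcases Nat.eq_zero_or_pos n with h | h
      · simp [h]
      · exact_mod_cast Nat.pow_le_pow_right h (by norm_num)
  have hsq : ∀ n : ℕ, (n : ℝ) ≤ (n : ℝ) ^ 2 := fun n => by
    exact_mod_cast Nat.le_self_pow (by norm_num) n
  have hms : ∀ (h : ℕ → ℝ) {X : Ω → ℕ}, Measurable X →
      AEStronglyMeasurable (fun ω => h (X ω)) P := fun h X hX =>
    ((measurable_of_countable h).comp hX).aestronglyMeasurable
  have hW1 : Integrable (fun ω => (W ω : ℝ)) P :=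
    hW3.mono' (hms (fun i => (i : ℝ)) hWmeas) (Filter.Eventually.of_forall fun ω => by
      simpa using (hcube (W ω)).1)
  have hW2 : Integrable (fun ω => (W ω : ℝ) ^ 2) P :=
    hW3.mono' (hms (fun i => (i : ℝ) ^ 2) hWmeas) (Filter.Eventually.of_forall fun ω => by
      simpa using (hcube (W ω)).2)
  have hvar : v = ∫ ω, (W ω : ℝ) ^ 2 ∂P - lam ^ 2 := by
    rw [hv, variance_eq_sub ((memLp_two_iff_integrable_sq hW1.1).2 hW2), hlam]
    rfl
  have hpos : 0 < ∫ ω, (W ω : ℝ) ∂P := hlam ▸ hlampos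
  have hsub : ∀ n : ℕ, (n : ℝ) * ((n - 1 : ℕ) : ℝ) = (n : ℝ) ^ 2 - n := fun n => by
    rcases n with _ | n
    · simp
    · simp; ring
  have hcpl := coupling_nonneg P lamBar W hWmeas hW1 hpos ξ hξmeas hcoupling
  have h1 := hcpl (fun i => ((i - 1 : ℕ) : ℝ)) (fun i => by positivity) (by
    simp only [hsub]; exact hW2.sub hW1)
  have h2 := hcpl (fun i => ((i - 1 : ℕ) : ℝ) ^ 2) (fun i => by positivity) (by
    have : ∀ n : ℕ, (n : ℝ) * ((n - 1 : ℕ) : ℝ) ^ 2 = (n : ℝ) ^ 3 - 2 * (n : ℝ) ^ 2 + n := by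
      intro n
      rcases n with _ | n
      · simp
      · simp; ring
    simp only [this]
    exact (hW3.sub (hW2.const_mul 2)).add hW1)
  have hsimp : ∀ α ω, ((W ω + 1 + ξ α ω - 1 : ℕ) : ℝ) = (W ω : ℝ) + ξ α ω := fun α ω => by
    rw [← Nat.cast_add]; congr 1; omega
  simp only [hsimp, hsub] at h1 h2
  obtain ⟨-, h1i, h1e⟩ := h1
  have hgood2 : ∀ᵐ α ∂lamBar, Integrable (fun ω => (ξ α ω : ℝ) ^ 2) P := by
    filter_upwards [h2.1] with α hα
    refine hα.mono' (hms (fun i => (i : ℝ) ^ 2) (hξmeas α)) (Filter.Eventually.of_forall fun ω => ?_)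
    rw [Real.norm_eq_abs, abs_of_nonneg (by positivity)]
    gcongr
    linarith [Nat.cast_nonneg (α := ℝ) (W ω)]
  have hgood : ∀ᵐ α ∂lamBar, Integrable (fun ω => (ξ α ω : ℝ)) P := by
    filter_upwards [hgood2] with α hα
    refine hα.mono' (hms (fun i => (i : ℝ)) (hξmeas α)) (Filter.Eventually.of_forall fun ω => ?_)
    simpa using hsq (ξ α ω)
  have heae : (fun α => ∫ ω, ((W ω : ℝ) + ξ α ω) ∂P) =ᵐ[lamBar]
      fun α => lam + ∫ ω, (ξ α ω : ℝ) ∂P := by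
    filter_upwards [hgood] with α hα
    rw [integral_add hW1 hα, hlam]
  have hei : Integrable (fun α => ∫ ω, (ξ α ω : ℝ) ∂P) lamBar := by
    refine ((h1i.congr heae).sub (integrable_const lam)).congr
      (Filter.Eventually.of_forall fun α => ?_)
    simp
  have hmass' : lamBar.real Set.univ = lam := hmass
  have hee : ∫ α, ∫ ω, (ξ α ω : ℝ) ∂P ∂lamBar = v - lam := by
    rw [integral_congr_ae heae, integral_add (integrable_const _) hei, integral_const, hmass',
      integral_sub hW2 hW1, ← hlam, smul_eq_mul] at h1e
    rw [hvar]; linarith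
  have hvl : 0 < v - lam := by linarith
  have hr0 : 0 < r := by rw [hr]; positivity
  have hq0 : 0 < q := by rw [hq]; positivity
  have hq1 : q < 1 := by rw [hq, div_lt_one hvpos]; exact hvlam
  set b : ℝ := 1 - q with hb
  have hb0 : 0 < b := by linarith
  have hb1 : b < 1 := by linarith
  have hbv : b * v = v - lam := by rw [hb, hq]; field_simp
  have h1b : (1 - b) * v = lam := by linarith
  have hav : r * b = lam ^ 2 / v := by
    have : b = (v - lam) / v := by rw [← hbv]; field_simp
    rw [this, hr]; field_simp
  have ha0 : 0 < r * b := by positivity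
  have hab : r * b = (1 - b) * lam := by
    have : 1 - b = lam / v := by rw [← h1b]; field_simp
    rw [hav, this]; ring
  set d := dTV (P.map W) (P.map (fun ω => W ω + 1)) with hd
  set S := ∫ α, (∫ ω, (ξ α ω : ℝ) * ((ξ α ω : ℝ) - 1) ∂P) ∂lamBar with hS
  have hrhs : d / lam ^ 2 * (2 * (v - lam) ^ 2 + lam * S) =
      b * 2 * (d / (r * b)) * (v - lam) + (1 - b) * (d / (r * b)) * S := by
    have e1 : b = (v - lam) / v := by rw [← hbv]; field_simp
    have e2 : 1 - b = lam / v := by rw [← h1b]; field_simp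
    rw [hav, e2, e1]
    field_simp
  rw [hrhs]
  refine ciSup_le fun A => ?_
  obtain ⟨g, ⟨C, hgC⟩, hg, hgd⟩ := stein_sol (r * b) b ha0 hb0 hb1 (nbPMF r q)
    (nb_pos hr0 hq0 hq1) (nb_hasSum hr0 hq0 hq1) (nb_db hr0) (A.indicator fun _ => 1)
    (fun i => Set.indicator_nonneg (fun _ _ => zero_le_one) i)
    (fun i => Set.indicator_le_self' (fun _ _ => zero_le_one) i)
  have hm : ∑' j, nbPMF r q j * A.indicator (fun _ => (1 : ℝ)) j
      = ∑' i, A.indicator (nbPMF r q) i := by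
    congr 1; ext j
    by_cases hj : j ∈ A <;> simp [hj]
  rw [hm] at hg
  set m := ∑' i, A.indicator (nbPMF r q) i
  have hPA : ((P.map W) A).toReal = ∫ ω, A.indicator (fun _ => (1 : ℝ)) (W ω) ∂P := by
    rw [← integral_map (f := A.indicator (fun _ => (1 : ℝ))) hWmeas.aemeasurable
      (measurable_of_countable _).aestronglyMeasurable,
      integral_indicator_const _ MeasurableSet.of_discrete]
    simp [measureReal_def]
  set u : ℕ → ℝ := fun k => ∫ ω, g (W ω + 1 + k) ∂P with hu
  have hmW : ∀ k, Measurable (fun ω => W ω + 1 + k) := fun k => (hWmeas.add_const 1).add_const k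
  have hgi : ∀ k, Integrable (fun ω => g (W ω + 1 + k)) P := fun k => bdd_integrable hgC (hmW k)
  have huC : ∀ k, |u k| ≤ C := fun k => by
    have := norm_integral_le_of_norm_le_const (μ := P) (f := fun ω => g (W ω + 1 + k)) (C := C)
      (Filter.Eventually.of_forall fun ω => hgC _)
    simpa using this
  have hud : ∀ k : ℕ, |(u (k + 1) - u k) - (u 1 - u 0)| ≤ 2 * (d / (r * b)) * k := fun k => by
    have := shift_bound P W hWmeas (fun i => g (i + 2) - g (i + 1)) (1 / (r * b)) (by positivity)
      hgd k
    have e1 : ∀ k, ∫ ω, (g (W ω + k + 2) - g (W ω + k + 1)) ∂P = u (k + 1) - u k := fun k => by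
      rw [hu]
      simp only
      rw [← integral_sub (hgi _) (hgi _)]
      congr 1; ext ω
      congr 2 <;> ring
    have e2 := e1 0
    simp only [add_zero, zero_add] at e2
    rw [e1, e2] at this
    refine this.trans (le_of_eq ?_)
    rw [← hd]; ring
  have hest := seq_est u b (d / (r * b)) hb0.le hb1.le hud
  set δ := u 1 - u 0 with hδ
  have hgC1 : ∀ i, |g (i + 1)| ≤ C := fun i => hgC _
  have hI1 := coupling_integrable P lamBar W hWmeas hW1 hpos ξ hξmeas hcoupling g C hgC
  have hI2 := coupling_integrable P lamBar W hWmeas hW1 hpos ξ hξmeas hcoupling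
    (fun i => g (i + 1)) C hgC1
  have hc1 := hcoupling g ⟨C, hgC⟩
  have hc2 := hcoupling (fun i => g (i + 1)) ⟨C, hgC1⟩
  have hWg : Integrable (fun ω => (W ω : ℝ) * g (W ω)) P :=
    hW1.mul_bdd (c := C) (hms g hWmeas) (Filter.Eventually.of_forall fun ω => hgC _)
  have hWg1 : Integrable (fun ω => (W ω : ℝ) * g (W ω + 1)) P :=
    hW1.mul_bdd (c := C) (hms (fun i => g (i + 1)) hWmeas)
      (Filter.Eventually.of_forall fun ω => hgC _)
  have hg0 : Integrable (fun ω => g (W ω + 1)) P := hgi 0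
  have hu0 : ∫ ω, g (W ω + 1) ∂P = u 0 := rfl
  have hstein : ((P.map W) A).toReal - m = r * b * u 0 + b * ∫ ω, (W ω : ℝ) * g (W ω + 1) ∂P
      - ∫ ω, (W ω : ℝ) * g (W ω) ∂P := by
    have hfi : Integrable (fun ω => A.indicator (fun _ => (1 : ℝ)) (W ω)) P :=
      bdd_integrable (C := 1) (fun i => by by_cases hi : i ∈ A <;> simp [hi]) hWmeas
    have : ∫ ω, (A.indicator (fun _ => (1 : ℝ)) (W ω) - m) ∂P =
        ∫ ω, (r * b * g (W ω + 1) + b * ((W ω : ℝ) * g (W ω + 1)) - (W ω : ℝ) * g (W ω)) ∂P := by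
      congr 1; ext ω
      rw [← hg (W ω)]; ring
    rw [integral_sub hfi (integrable_const _), lin3 hg0 hWg1 hWg, ← hPA, hu0] at this
    simpa using this
  set R : Γ → ℝ := fun α => (1 - b) * u 0 + b * ∫ ω, g (W ω + 1 + ξ α ω + 1) ∂P
    - ∫ ω, g (W ω + 1 + ξ α ω) ∂P - b * δ + (1 - b) * δ * ∫ ω, (ξ α ω : ℝ) ∂P with hR
  have hRint : ∫ α, R α ∂lamBar = ((P.map W) A).toReal - m := by
    simp only [hR]
    rw [lin5 hI2 hI1 hei, hmass', hee, ← hc1, ← hc2, hstein, hab]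
    linear_combination (-δ) * hbv
  rw [← hRint, ← Real.norm_eq_abs]
  have hfin : ∫ α, (b * 2 * (d / (r * b)) * ∫ ω, (ξ α ω : ℝ) ∂P) +
      (1 - b) * (d / (r * b)) * ∫ ω, (ξ α ω : ℝ) * ((ξ α ω : ℝ) - 1) ∂P ∂lamBar
      = b * 2 * (d / (r * b)) * (v - lam) + (1 - b) * (d / (r * b)) * S := by
    rw [integral_add (hei.const_mul _) (hξint.const_mul _), integral_const_mul, integral_const_mul,
      hee]
  rw [← hfin]
  refine norm_integral_le_of_norm_le ((hei.const_mul _).add (hξint.const_mul _)) ?_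
  filter_upwards [hgood, hgood2] with α hα hα2
  have i1 := indep_integral P W (ξ α) hWmeas (hξmeas α) (hξindep α) g C hgC
  have i2 := indep_integral P W (ξ α) hWmeas (hξmeas α) (hξindep α) (fun i => g (i + 1)) C hgC1
  have j1 : Integrable (fun ω => u (ξ α ω)) P := bdd_integrable huC (hξmeas α)
  have j2 : Integrable (fun ω => u (ξ α ω + 1)) P :=
    bdd_integrable (h := fun k => u (k + 1)) (fun i => huC _) (hξmeas α)
  have j3 : Integrable (fun ω => (ξ α ω : ℝ) * ((ξ α ω : ℝ) - 1)) P := by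
    refine (hα2.sub hα).congr (Filter.Eventually.of_forall fun ω => ?_)
    simp only [Pi.sub_apply]; ring
  have hRα : R α = ∫ ω, ((1 - b) * u 0 + b * u (ξ α ω + 1) - u (ξ α ω) - b * δ
      + (1 - b) * δ * (ξ α ω : ℝ)) ∂P := by
    rw [lin5 j2 j1 hα]
    simp only [hR]
    rw [i1, i2]
    simp [hu, add_assoc]
  rw [hRα, ← integral_const_mul (b * 2 * (d / (r * b))) (fun ω => (ξ α ω : ℝ)),
    ← integral_const_mul ((1 - b) * (d / (r * b))) (fun ω => (ξ α ω : ℝ) * ((ξ α ω : ℝ) - 1)),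
    ← integral_add (hα.const_mul _) (j3.const_mul _)]
  exact norm_integral_le_of_norm_le ((hα.const_mul _).add (j3.const_mul _))
    (Filter.Eventually.of_forall fun ω => hest (ξ α ω))
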